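/- Let π : (X,T) → (Y,R) be a factor map between ℤ-systems, μ a T-invariant Borel probability measure on X, and 𝒰 a finite Borel cover of X. With the uniform system of coefficients c^n_S = 2^{−n}, if μ = ∫_Ω μ_ω dm(ω) is the ergodic decomposition of μ, then Asc_μ^-(T,𝒰|Y) = ∫_Ω Asc_{μ_ω}^-(T,𝒰|Y) dm(ω). -/

import Mathlib

open MeasureTheory Filter Set

noncomputable section

namespace AscLocal

/-- Limit of a real sequence (a junk value if the sequence does not converge). -/
def limSeq (f : ℕ → ℝ) : ℝ := limUnder Filter.atTop f

variable {G X Y : Type*}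

/-- `U` is a cover of the whole space. -/
def IsCover (U : Finset (Set X)) : Prop := ⋃₀ (U : Set (Set X)) = Set.univ

/-- every member of `α` is contained in some member of `U` (`α ⪰ U`). -/
def Refines (α U : Finset (Set X)) : Prop := ∀ A ∈ α, ∃ B ∈ U, A ⊆ B

/-- `α` is a finite measurable partition of the space. -/
def IsMPartition [MeasurableSpace X] (α : Finset (Set X)) : Prop :=
  IsCover α ∧ (∀ A ∈ α, MeasurableSet A) ∧
    ∀ A ∈ α, ∀ B ∈ α, A ≠ B → Disjoint A B

/-- Følner sequence of a group. -/
def IsFolner [Group G] [DecidableEq G] (F : ℕ → Finset G) : Prop :=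
  (∀ n, (F n).Nonempty) ∧
    ∀ g : G, Tendsto (fun n =>
      ((((((F n).image fun h => g * h) \ F n) ∪ (F n \ ((F n).image fun h => g * h)))).card : ℝ)
        / ((F n).card : ℝ)) atTop (nhds 0)

/-- The join `⋁_{g ∈ S} g⁻¹ U` of the pullbacks of the cover `U` under the action `act`. -/
def coverDyn [DecidableEq G] (act : G → X → X) (U : Finset (Set X)) (S : Finset G) :
    Finset (Set X) := by
  classical
  exact (S.pi fun _ => U).image fun f => ⋂ g, ⋂ (h : g ∈ S), act g ⁻¹' f g h

/-- The join `⋁_{i ∈ S} T^{-i} U` for a single transformation `T`. -/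
def coverIt (T : X → X) (U : Finset (Set X)) (S : Finset ℕ) : Finset (Set X) := by
  classical
  exact (S.pi fun _ => U).image fun f => ⋂ i, ⋂ (h : i ∈ S), (T^[i]) ⁻¹' f i h

/-- join of two finite families of sets. -/
def joinP (α β : Finset (Set X)) : Finset (Set X) := by
  classical
  exact (α ×ˢ β).image fun p => p.1 ∩ p.2

/-- minimal number of members of `U` needed to cover `K`. -/
def covNum (U : Finset (Set X)) (K : Set X) : ℕ :=
  sInf {n | ∃ V : Finset (Set X), V ⊆ U ∧ V.card = n ∧ K ⊆ ⋃₀ (V : Set (Set X))}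

/-- `N(U|Y) = sup_y N(U | pr⁻¹ y)` for a factor map `pr : X → Y`. -/
def covNumRel (pr : X → Y) (U : Finset (Set X)) : ℕ :=
  sSup {n | ∃ y : Y, n = covNum U (pr ⁻¹' {y})}

/-- Shannon entropy of a finite partition. -/
def entPart [MeasurableSpace X] (μ : Measure X) (α : Finset (Set X)) : ℝ :=
  ∑ A ∈ α, Real.negMulLog (μ A).toReal

/-- entropy of a finite cover: infimum over finer partitions. -/
def entCov [MeasurableSpace X] (μ : Measure X) (U : Finset (Set X)) : ℝ :=
  sInf {h | ∃ α, IsMPartition (X := X) α ∧ Refines α U ∧ h = entPart μ α}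

/-- conditional entropy of a partition given the σ-algebra `pr⁻¹ ℬ(Y)`:
`H_μ(α|Y) = ∑_{A ∈ α} ∫ -E(1_A|pr⁻¹ ℬ(Y)) log E(1_A|pr⁻¹ ℬ(Y)) dμ`. -/
def condEntPart [MeasurableSpace X] [MeasurableSpace Y] (μ : Measure X) (pr : X → Y)
    (α : Finset (Set X)) : ℝ :=
  ∑ A ∈ α, ∫ x, Real.negMulLog
    ((μ[A.indicator (fun _ => (1 : ℝ)) | MeasurableSpace.comap pr ‹_›]) x) ∂μ

/-- conditional entropy of a cover given `pr⁻¹ ℬ(Y)`: infimum over finer partitions. -/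
def condEntCover [MeasurableSpace X] [MeasurableSpace Y] (μ : Measure X) (pr : X → Y)
    (U : Finset (Set X)) : ℝ :=
  sInf {h | ∃ α, IsMPartition (X := X) α ∧ Refines α U ∧ h = condEntPart μ pr α}

/-- the coefficient `c^A_S = ∫ x^{|S|} (1-x)^{|A|-|S|} dλ(x)`. -/
def coeff (lam : Measure ℝ) (A S : Finset G) : ℝ :=
  ∫ x, x ^ S.card * (1 - x) ^ (A.card - S.card) ∂lam

/-- `lam` is a symmetric probability measure on `[0,1]`. -/
def IsCoeffMeasure (lam : Measure ℝ) : Prop :=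
  IsProbabilityMeasure lam ∧ lam (Set.Icc (0 : ℝ) 1)ᶜ = 0 ∧
    lam.map (fun x => 1 - x) = lam

/-- the uniform system of coefficients `c^A_S = 2^{-|A|}`. -/
def unifCoeff (A _S : Finset G) : ℝ := (1 / 2) ^ A.card

/-- the finite family `{U 0, …, U (d-1)}` as a `Finset` of sets. -/
def ofFun {d : ℕ} (U : Fin d → Set X) : Finset (Set X) := by
  classical
  exact Finset.univ.image U

section GroupAsc

variable [Group G] [DecidableEq G]

/-- the sequence `n ↦ (1/|F_n|) ∑_{S ⊆ F_n} c^{F_n}_S H_μ(α_S|Y)`. -/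
def ascCondPartSeq [MeasurableSpace X] [MeasurableSpace Y] (μ : Measure X) (pr : X → Y)
    (c : Finset G → Finset G → ℝ) (act : G → X → X) (α : Finset (Set X))
    (F : ℕ → Finset G) (n : ℕ) : ℝ :=
  (1 / ((F n).card : ℝ)) *
    ∑ S ∈ (F n).powerset, c (F n) S * condEntPart μ pr (coverDyn act α S)

/-- `Asc_μ(G,α|Y)`. -/
def AscCondPart [MeasurableSpace X] [MeasurableSpace Y] (μ : Measure X) (pr : X → Y)
    (c : Finset G → Finset G → ℝ) (act : G → X → X) (α : Finset (Set X))
    (F : ℕ → Finset G) : ℝ :=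
  limSeq (ascCondPartSeq μ pr c act α F)

/-- `Asc_μ^-(G,U|Y)`. -/
def AscCondMinus [MeasurableSpace X] [MeasurableSpace Y] (μ : Measure X) (pr : X → Y)
    (c : Finset G → Finset G → ℝ) (act : G → X → X) (U : Finset (Set X))
    (F : ℕ → Finset G) : ℝ :=
  limSeq fun n => (1 / ((F n).card : ℝ)) *
    ∑ S ∈ (F n).powerset, c (F n) S * condEntCover μ pr (coverDyn act U S)

/-- `Asc_μ^+(G,U|Y)`. -/
def AscCondPlus [MeasurableSpace X] [MeasurableSpace Y] (μ : Measure X) (pr : X → Y)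
    (c : Finset G → Finset G → ℝ) (act : G → X → X) (U : Finset (Set X))
    (F : ℕ → Finset G) : ℝ :=
  sInf {h | ∃ α, IsMPartition (X := X) α ∧ Refines α U ∧ h = AscCondPart μ pr c act α F}

/-- `Asc_μ(G,X|Y) = sup_α Asc_μ(G,α|Y)`. -/
def AscCondSup [MeasurableSpace X] [MeasurableSpace Y] (μ : Measure X) (pr : X → Y)
    (c : Finset G → Finset G → ℝ) (act : G → X → X) (F : ℕ → Finset G) : ℝ :=
  sSup {h | ∃ α, IsMPartition (X := X) α ∧ h = AscCondPart μ pr c act α F}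

/-- unconditional `Asc_μ(G,α)`. -/
def AscPart [MeasurableSpace X] (μ : Measure X)
    (c : Finset G → Finset G → ℝ) (act : G → X → X) (α : Finset (Set X))
    (F : ℕ → Finset G) : ℝ :=
  limSeq fun n => (1 / ((F n).card : ℝ)) *
    ∑ S ∈ (F n).powerset, c (F n) S * entPart μ (coverDyn act α S)

/-- unconditional `Asc_μ^-(G,U)`. -/
def AscMinus [MeasurableSpace X] (μ : Measure X)
    (c : Finset G → Finset G → ℝ) (act : G → X → X) (U : Finset (Set X))
    (F : ℕ → Finset G) : ℝ :=
  limSeq fun n => (1 / ((F n).card : ℝ)) *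
    ∑ S ∈ (F n).powerset, c (F n) S * entCov μ (coverDyn act U S)

/-- unconditional `Asc_μ^+(G,U)`. -/
def AscPlus [MeasurableSpace X] (μ : Measure X)
    (c : Finset G → Finset G → ℝ) (act : G → X → X) (U : Finset (Set X))
    (F : ℕ → Finset G) : ℝ :=
  sInf {h | ∃ α, IsMPartition (X := X) α ∧ Refines α U ∧ h = AscPart μ c act α F}

/-- conditional topological average sample complexity `Asc_top(G,U|Y)`. -/
def AscTopRel (c : Finset G → Finset G → ℝ) (act : G → X → X) (pr : X → Y)
    (U : Finset (Set X)) (F : ℕ → Finset G) : ℝ :=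
  limSeq fun n => (1 / ((F n).card : ℝ)) *
    ∑ S ∈ (F n).powerset, c (F n) S * Real.log (covNumRel pr (coverDyn act U S))

/-- topological average sample complexity `Asc_top(G,U)`. -/
def AscTop (c : Finset G → Finset G → ℝ) (act : G → X → X)
    (U : Finset (Set X)) (F : ℕ → Finset G) : ℝ :=
  limSeq fun n => (1 / ((F n).card : ℝ)) *
    ∑ S ∈ (F n).powerset, c (F n) S * Real.log (covNum (coverDyn act U S) Set.univ)

/-- `ν` is `G`-invariant and ergodic for the action `act`. -/
def IsErgodicAct [MeasurableSpace X] (act : G → X → X) (ν : Measure X) : Prop :=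
  (∀ g, Measure.map (act g) ν = ν) ∧
    ∀ A : Set X, MeasurableSet A → (∀ g, act g ⁻¹' A = A) → ν A = 0 ∨ ν A = 1

end GroupAsc

/-- `Asc_μ(T,α|Y)` for a `ℤ`-system, uniform coefficients `2^{-n}`. -/
def zAscCondPart [MeasurableSpace X] [MeasurableSpace Y] (μ : Measure X) (pr : X → Y)
    (T : X → X) (α : Finset (Set X)) : ℝ :=
  limSeq fun n => (1 / (n : ℝ)) * ∑ S ∈ (Finset.range n).powerset,
    ((1 : ℝ) / 2) ^ n * condEntPart μ pr (coverIt T α S)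

/-- `Asc_μ^-(T,U|Y)` for a `ℤ`-system, uniform coefficients. -/
def zAscCondMinus [MeasurableSpace X] [MeasurableSpace Y] (μ : Measure X) (pr : X → Y)
    (T : X → X) (U : Finset (Set X)) : ℝ :=
  limSeq fun n => (1 / (n : ℝ)) * ∑ S ∈ (Finset.range n).powerset,
    ((1 : ℝ) / 2) ^ n * condEntCover μ pr (coverIt T U S)

/-- `Asc_μ^+(T,U|Y)` for a `ℤ`-system, uniform coefficients. -/
def zAscCondPlus [MeasurableSpace X] [MeasurableSpace Y] (μ : Measure X) (pr : X → Y)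
    (T : X → X) (U : Finset (Set X)) : ℝ :=
  sInf {h | ∃ α, IsMPartition (X := X) α ∧ Refines α U ∧ h = zAscCondPart μ pr T α}

/-- `Asc_top(T,U|Y)` for a `ℤ`-system, uniform coefficients. -/
def zAscTop (T : X → X) (pr : X → Y) (U : Finset (Set X)) : ℝ :=
  limSeq fun n => (1 / (n : ℝ)) * ∑ S ∈ (Finset.range n).powerset,
    ((1 : ℝ) / 2) ^ n * Real.log (covNumRel pr (coverIt T U S))

end AscLocal

open AscLocal

namespace Sub13

universe u v

set_option linter.unusedSectionVars false

lemma cp_facts {X : Type u} {Y : Type v} [MeasurableSpace X] [MeasurableSpace Y]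
    (ν : Measure X) [IsProbabilityMeasure ν] {pr : X → Y} (hpr : Measurable pr)
    {A : Set X} (hA : MeasurableSet A) :
    ∃ h : Y → ℝ, Measurable h ∧ (∀ y, 0 ≤ h y) ∧ (∀ y, h y ≤ 1) ∧
      (∫ x, Real.negMulLog ((ν[A.indicator (fun _ => (1 : ℝ)) | MeasurableSpace.comap pr ‹_›]) x) ∂ν
        = ∫ x, Real.negMulLog (h (pr x)) ∂ν) ∧
      ∀ f : Y → ℝ, Measurable f → (∃ C, ∀ y, |f y| ≤ C) →
        ∫ x, h (pr x) * f (pr x) ∂ν = ∫ x, A.indicator (fun x => f (pr x)) x ∂ν := by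
  have hle : MeasurableSpace.comap pr ‹MeasurableSpace Y› ≤ ‹MeasurableSpace X› := hpr.comap_le
  set p := ν[A.indicator (fun _ => (1 : ℝ)) | MeasurableSpace.comap pr ‹_›] with hp
  have hint : Integrable (A.indicator (fun _ => (1 : ℝ))) ν := (integrable_const 1).indicator hA
  have hsm : StronglyMeasurable[MeasurableSpace.comap pr ‹_›] p := stronglyMeasurable_condExp
  obtain ⟨h0, h0m, h0e⟩ := hsm.exists_eq_measurable_comp
  have hp0 : 0 ≤ᵐ[ν] p := condExp_nonneg (Eventually.of_forall fun x => by
    by_cases hx : x ∈ A <;> simp [hx])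
  have hp1 : p ≤ᵐ[ν] fun _ => 1 := by
    have := condExp_mono (m := MeasurableSpace.comap pr ‹_›) hint (integrable_const (1:ℝ))
      (Eventually.of_forall fun x => by by_cases hx : x ∈ A <;> simp [hx])
    rwa [condExp_const hle] at this
  have heq : p =ᵐ[ν] fun x => max 0 (min 1 (h0 (pr x))) := by
    filter_upwards [hp0, hp1] with x h1 h2
    have : p x = h0 (pr x) := congrFun h0e x
    simp only [Pi.zero_apply] at h1
    rw [← this, min_eq_right h2, max_eq_right h1]
  refine ⟨fun y => max 0 (min 1 (h0 y)), by fun_prop, fun y => le_max_left _ _,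
    fun y => by simp, ?_, ?_⟩
  · exact integral_congr_ae (heq.mono fun x hx => by simp only [hx])
  · rintro f hf ⟨C, hC⟩
    have hfm : StronglyMeasurable[MeasurableSpace.comap pr ‹_›] (fun x => f (pr x)) :=
      (hf.comp (comap_measurable pr)).stronglyMeasurable
    have hfi : Integrable (A.indicator (fun x => f (pr x))) ν :=
      (Integrable.of_bound (hf.comp hpr).aestronglyMeasurable C
        (Eventually.of_forall fun x => hC (pr x))).indicator hA
    have hmul : (A.indicator (fun _ => (1:ℝ))) * (fun x => f (pr x))
        = A.indicator (fun x => f (pr x)) := by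
      ext x; by_cases hx : x ∈ A <;> simp [hx]
    have key := condExp_mul_of_stronglyMeasurable_right (μ := ν) hfm (by rwa [hmul]) hint
    rw [hmul] at key
    rw [← integral_condExp hle (f := A.indicator (fun x => f (pr x)))]
    refine integral_congr_ae ?_
    filter_upwards [key, heq] with x h1 h2
    rw [h1, Pi.mul_apply, ← hp, h2]

def IsCode {X : Type u} {Y : Type v} [MeasurableSpace X] [MeasurableSpace Y]
    (pr : X → Y) (W : Finset (Set X)) (φ : X → ℝ) : Prop :=
  ∃ (κ : Type u) (_ : Fintype κ) (l : κ → Y → ℝ) (c : X → κ),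
    (∀ k, Measurable (l k)) ∧ (∃ C, ∀ k y, |l k y| ≤ C) ∧
    (∀ y, ∑ k, Real.exp (l k y) ≤ 1) ∧ (∀ k, MeasurableSet (c ⁻¹' {k})) ∧
    (∀ k, ∃ B ∈ W, c ⁻¹' {k} ⊆ B) ∧ ∀ x, φ x = -l (c x) (pr x)

section
variable {X : Type u} {Y : Type v} [MeasurableSpace X] [MeasurableSpace Y]
  {pr : X → Y} {W : Finset (Set X)} {φ : X → ℝ}

lemma sum_ind {κ : Type*} [Fintype κ] (c : X → κ) (F : κ → X → ℝ) (x : X) :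
    F (c x) x = ∑ k, (c ⁻¹' {k}).indicator (F k) x := by
  classical
  rw [Finset.sum_eq_single (c x)]
  · simp
  · intro k _ hk
    rw [indicator_of_notMem]
    simpa using fun h => hk h.symm
  · simp

lemma IsCode.meas (hpr : Measurable pr) (h : IsCode pr W φ) : Measurable φ := by
  obtain ⟨κ, _, l, c, hl, hb, hs, hc, hW, hφ⟩ := h
  have : φ = fun x => ∑ k, (c ⁻¹' {k}).indicator (fun x => -l k (pr x)) x := by
    ext x; rw [hφ, ← sum_ind c (fun k x => -l k (pr x))]
  rw [this]
  exact Finset.measurable_sum _ fun k _ => (((hl k).comp hpr).neg).indicator (hc k)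

lemma IsCode.bdd (h : IsCode pr W φ) : ∃ C, ∀ x, |φ x| ≤ C := by
  obtain ⟨κ, _, l, c, hl, ⟨C, hC⟩, hs, hc, hW, hφ⟩ := h
  exact ⟨C, fun x => by rw [hφ, abs_neg]; exact hC _ _⟩

lemma IsCode.int (hpr : Measurable pr) (h : IsCode pr W φ) (ν : Measure X)
    [IsProbabilityMeasure ν] : Integrable φ ν := by
  obtain ⟨C, hC⟩ := h.bdd
  exact Integrable.of_bound (h.meas hpr).aestronglyMeasurable C (Eventually.of_forall hC)

lemma negMulLog_le {p l : ℝ} (hp : 0 ≤ p) : Real.negMulLog p ≤ p * (-l) + Real.exp l - p := by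
  rcases hp.eq_or_lt with rfl | hp
  · simp [Real.exp_nonneg]
  · have h1 := Real.add_one_le_exp (l - Real.log p)
    rw [Real.exp_sub, Real.exp_log hp, le_div_iff₀ hp] at h1
    rw [Real.negMulLog]; nlinarith

lemma condEntPart_nonneg (ν : Measure X) [IsProbabilityMeasure ν] (hpr : Measurable pr)
    {α : Finset (Set X)} (hα : ∀ A ∈ α, MeasurableSet A) : 0 ≤ condEntPart ν pr α := by
  refine Finset.sum_nonneg fun A hA => ?_
  obtain ⟨h, hm, h0, h1, he, -⟩ := cp_facts ν hpr (hα A hA)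
  rw [he]
  exact integral_nonneg fun x => Real.negMulLog_nonneg (h0 _) (h1 _)

lemma condEntCover_bdd (ν : Measure X) [IsProbabilityMeasure ν] (hpr : Measurable pr) :
    ∀ h ∈ {h | ∃ α, IsMPartition (X := X) α ∧ Refines α W ∧ h = condEntPart ν pr α}, 0 ≤ h := by
  rintro h ⟨α, hα, -, rfl⟩
  exact condEntPart_nonneg ν hpr hα.2.1

lemma IsCode.part (ν : Measure X) [IsProbabilityMeasure ν] (hpr : Measurable pr)
    (h : IsCode pr W φ) : ∃ α, IsMPartition (X := X) α ∧ Refines α W ∧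
      condEntPart ν pr α ≤ ∫ x, φ x ∂ν := by
  classical
  have hint := h.int hpr ν
  obtain ⟨κ, _, l, c, hl, ⟨C, hC⟩, hs, hc, hW, hφ⟩ := h
  refine ⟨Finset.univ.image fun k => c ⁻¹' {k}, ⟨?_, ?_, ?_⟩, ?_, ?_⟩
  · ext x; simp
  · simpa using hc
  · simp only [Finset.mem_image, Finset.mem_univ, true_and]
    rintro _ ⟨i, rfl⟩ _ ⟨j, rfl⟩ hij
    refine Disjoint.preimage _ ?_
    rw [Set.disjoint_singleton]
    rintro rfl; exact hij rfl
  · intro A hA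
    simp only [Finset.mem_image, Finset.mem_univ, true_and] at hA
    obtain ⟨k, rfl⟩ := hA
    exact hW k
  · choose h hm h0 h1 he hf using fun k => cp_facts ν hpr (hc k)
    have I1 : ∀ k, Integrable (fun x => h k (pr x)) ν := fun k =>
      Integrable.of_bound ((hm k).comp hpr).aestronglyMeasurable 1
        (Eventually.of_forall fun x => by
          rw [Real.norm_eq_abs, abs_of_nonneg (h0 _ _)]; exact h1 _ _)
    have I2 : ∀ k, Integrable (fun x => h k (pr x) * (-l k (pr x))) ν := fun k => by
      refine Integrable.of_bound (((hm k).comp hpr).mul ((hl k).comp hpr).neg).aestronglyMeasurable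
        C (Eventually.of_forall fun x => ?_)
      rw [Real.norm_eq_abs, abs_mul, abs_of_nonneg (h0 _ _), abs_neg]
      calc _ ≤ 1 * C := mul_le_mul (h1 _ _) (hC _ _) (abs_nonneg _) zero_le_one
        _ = C := one_mul _
    have I3 : ∀ k, Integrable (fun x => Real.exp (l k (pr x))) ν := fun k => by
      refine Integrable.of_bound (Real.measurable_exp.comp ((hl k).comp hpr)).aestronglyMeasurable
        (Real.exp C) (Eventually.of_forall fun x => ?_)
      rw [Real.norm_eq_abs, abs_of_nonneg (Real.exp_nonneg _)]
      exact Real.exp_le_exp.2 (le_of_abs_le (hC _ _))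
    have I4 : ∀ k, Integrable (fun x => Real.negMulLog (h k (pr x))) ν := fun k => by
      refine Integrable.of_bound (Real.continuous_negMulLog.measurable.comp
        ((hm k).comp hpr)).aestronglyMeasurable 1 (Eventually.of_forall fun x => ?_)
      rw [Real.norm_eq_abs, abs_of_nonneg (Real.negMulLog_nonneg (h0 _ _) (h1 _ _))]
      have := negMulLog_le (l := 0) (h0 k (pr x))
      have := h0 k (pr x)
      simp at *; linarith
    have S1 : ∑ k, ∫ x, h k (pr x) ∂ν = 1 := by
      have : ∀ k, ∫ x, h k (pr x) ∂ν = ∫ x, (c ⁻¹' {k}).indicator (fun _ => (1:ℝ)) x ∂ν := by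
        intro k
        have := hf k (fun _ => 1) measurable_const ⟨1, by simp⟩
        simpa using this
      simp_rw [this]
      rw [← integral_finsetSum _ (fun k _ => (integrable_const 1).indicator (hc k))]
      have : ∀ x, ∑ k, (c ⁻¹' {k}).indicator (fun _ => (1:ℝ)) x = 1 := fun x =>
        (sum_ind c (fun _ _ => (1:ℝ)) x).symm
      simp [this]
    have S2 : ∑ k, ∫ x, h k (pr x) * (-l k (pr x)) ∂ν = ∫ x, φ x ∂ν := by
      have : ∀ k, ∫ x, h k (pr x) * (-l k (pr x)) ∂ν
          = ∫ x, (c ⁻¹' {k}).indicator (fun x => -l k (pr x)) x ∂ν := fun k =>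
        hf k (fun y => -l k y) (hl k).neg ⟨C, fun y => by rw [abs_neg]; exact hC _ _⟩
      simp_rw [this]
      rw [← integral_finsetSum]
      · refine integral_congr_ae (Eventually.of_forall fun x => ?_)
        simp only [hφ]
        exact (sum_ind c (fun k x => -l k (pr x)) x).symm
      · intro k _
        exact (Integrable.of_bound ((hl k).comp hpr).neg.aestronglyMeasurable C
          (Eventually.of_forall fun x => by
            simpa using hC k (pr x))).indicator (hc k)
    have S3 : ∑ k, ∫ x, Real.exp (l k (pr x)) ∂ν ≤ 1 := by
      rw [← integral_finsetSum _ (fun k _ => I3 k)]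
      calc _ ≤ ∫ x, (1:ℝ) ∂ν := integral_mono (integrable_finsetSum _ fun k _ => I3 k)
              (integrable_const _) (fun x => hs (pr x))
        _ = 1 := by simp
    calc condEntPart ν pr (Finset.univ.image fun k => c ⁻¹' {k})
        ≤ ∑ k, ∫ x, Real.negMulLog
            ((ν[(c ⁻¹' {k}).indicator (fun _ => (1 : ℝ)) | MeasurableSpace.comap pr ‹_›]) x) ∂ν := by
          rw [condEntPart]
          refine Finset.sum_image_le_of_nonneg (f := fun A : Set X => ∫ x, Real.negMulLog ((ν[A.indicator (fun _ => (1 : ℝ)) | MeasurableSpace.comap pr ‹_›]) x) ∂ν) ?_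
          intro B hB
          obtain ⟨k, -, rfl⟩ := Finset.mem_image.1 hB
          rw [he]
          exact integral_nonneg fun x => Real.negMulLog_nonneg (h0 _ _) (h1 _ _)
      _ = ∑ k, ∫ x, Real.negMulLog (h k (pr x)) ∂ν := Finset.sum_congr rfl fun k _ => he k
      _ ≤ ∑ k, ∫ x, (h k (pr x) * (-l k (pr x)) + Real.exp (l k (pr x)) - h k (pr x)) ∂ν :=
          Finset.sum_le_sum fun k _ => integral_mono (I4 k) (((I2 k).add (I3 k)).sub (I1 k))
            fun x => negMulLog_le (h0 _ _)
      _ = ∑ k, (∫ x, h k (pr x) * (-l k (pr x)) ∂ν + ∫ x, Real.exp (l k (pr x)) ∂ν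
            - ∫ x, h k (pr x) ∂ν) := by
          refine Finset.sum_congr rfl fun k _ => ?_
          have e1 := integral_sub ((I2 k).add (I3 k)) (I1 k)
          have e2 := integral_add (I2 k) (I3 k)
          simp only [Pi.add_apply] at e1
          rw [e1, e2]
      _ ≤ ∫ x, φ x ∂ν := by
          rw [Finset.sum_sub_distrib, Finset.sum_add_distrib, S1, S2]; linarith

lemma IsCode.le (ν : Measure X) [IsProbabilityMeasure ν] (hpr : Measurable pr)
    (h : IsCode pr W φ) : condEntCover ν pr W ≤ ∫ x, φ x ∂ν := by
  obtain ⟨α, h1, h2, h3⟩ := h.part ν hpr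
  exact (csInf_le ⟨0, condEntCover_bdd ν hpr⟩ ⟨α, h1, h2, rfl⟩).trans h3

lemma condEntCover_nonneg (ν : Measure X) [IsProbabilityMeasure ν] (hpr : Measurable pr) :
    0 ≤ condEntCover ν pr W := Real.sInf_nonneg (condEntCover_bdd ν hpr)

/-- binary mixing -/
lemma IsCode.mix {ψ : X → ℝ} (hpr : Measurable pr) (h : IsCode pr W φ) (h' : IsCode pr W ψ) :
    IsCode pr W (fun x => min (φ x) (ψ x) + Real.log 2) := by
  classical
  have mφ := h.meas hpr
  have mψ := h'.meas hpr
  obtain ⟨κ, _, l, c, hl, ⟨C, hC⟩, hs, hc, hW, hφ⟩ := h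
  obtain ⟨κ', _, l', c', hl', ⟨C', hC'⟩, hs', hc', hW', hφ'⟩ := h'
  have hset : MeasurableSet {x | φ x ≤ ψ x} := measurableSet_le mφ mψ
  have P1 : ∀ k : κ, (fun x => if φ x ≤ ψ x then (Sum.inl (c x) : κ ⊕ κ') else Sum.inr (c' x)) ⁻¹'
      {Sum.inl k} = {x | φ x ≤ ψ x} ∩ c ⁻¹' {k} := by
    intro k; ext x; by_cases hx : φ x ≤ ψ x <;> simp [hx]
  have P2 : ∀ k : κ', (fun x => if φ x ≤ ψ x then (Sum.inl (c x) : κ ⊕ κ') else Sum.inr (c' x)) ⁻¹'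
      {Sum.inr k} = {x | φ x ≤ ψ x}ᶜ ∩ c' ⁻¹' {k} := by
    intro k; ext x; by_cases hx : φ x ≤ ψ x <;> simp [hx]
  refine ⟨κ ⊕ κ', inferInstance, Sum.elim (fun k y => l k y - Real.log 2)
    (fun k y => l' k y - Real.log 2),
    fun x => if φ x ≤ ψ x then Sum.inl (c x) else Sum.inr (c' x), ?_, ?_, ?_, ?_, ?_, ?_⟩
  · rintro (k | k)
    · exact (hl k).sub_const _
    · exact (hl' k).sub_const _
  · refine ⟨max C C' + |Real.log 2|, ?_⟩
    rintro (k | k) y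
    · exact (abs_sub _ _).trans (add_le_add ((hC k y).trans (le_max_left _ _)) le_rfl)
    · exact (abs_sub _ _).trans (add_le_add ((hC' k y).trans (le_max_right _ _)) le_rfl)
  · intro y
    simp only [Fintype.sum_sum_type, Sum.elim_inl, Sum.elim_inr, Real.exp_sub,
      Real.exp_log (zero_lt_two' ℝ), ← Finset.sum_div]
    linarith [hs y, hs' y]
  · rintro (k | k)
    · rw [P1]; exact hset.inter (hc k)
    · rw [P2]; exact hset.compl.inter (hc' k)
  · rintro (k | k)
    · rw [P1]; obtain ⟨B, hB, h⟩ := hW k; exact ⟨B, hB, inter_subset_right.trans h⟩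
    · rw [P2]; obtain ⟨B, hB, h⟩ := hW' k; exact ⟨B, hB, inter_subset_right.trans h⟩
  · intro x
    by_cases hx : φ x ≤ ψ x
    · simp only [hx, if_true, min_eq_left hx, Sum.elim_inl]; rw [hφ x]; ring
    · simp only [hx, if_false, min_eq_right (not_le.1 hx).le, Sum.elim_inr]; rw [hφ' x]; ring

lemma mem_coverIt {T : X → X} {U : Finset (Set X)} {S : Finset ℕ} {B : Set X} :
    B ∈ coverIt T U S ↔ ∃ f : ℕ → Set X, (∀ i ∈ S, f i ∈ U) ∧ B = {x | ∀ i ∈ S, T^[i] x ∈ f i} := by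
  classical
  simp only [coverIt, Finset.mem_image, Finset.mem_pi]
  constructor
  · rintro ⟨f, hf, rfl⟩
    refine ⟨fun i => if h : i ∈ S then f i h else ∅, fun i hi => by simpa [hi] using hf i hi, ?_⟩
    ext x
    simp only [mem_iInter, mem_preimage, mem_ofPred_eq]
    exact forall_congr' fun i => forall_congr' fun hi => by simp [hi]
  · rintro ⟨f, hf, rfl⟩
    refine ⟨fun i _ => f i, hf, ?_⟩
    ext x
    simp

lemma IsCode.join {T : X → X} {R : Y → Y} (hT : Measurable T) (hR : Measurable R)
    (hfac : ∀ x, pr (T x) = R (pr x)) {U : Finset (Set X)} {S S₁ S₂ : Finset ℕ} {n : ℕ}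
    (hS : ∀ i ∈ S, i ∈ S₁ ∨ (n ≤ i ∧ i - n ∈ S₂))
    {ψ : X → ℝ} (h : IsCode pr (coverIt T U S₁) φ) (h' : IsCode pr (coverIt T U S₂) ψ) :
    IsCode pr (coverIt T U S) (fun x => φ x + ψ (T^[n] x)) := by
  classical
  obtain ⟨κ, _, l, c, hl, ⟨C, hC⟩, hs, hc, hW, hφ⟩ := h
  obtain ⟨κ', _, l', c', hl', ⟨C', hC'⟩, hs', hc', hW', hφ'⟩ := h'
  have hfacn : ∀ n x, pr (T^[n] x) = R^[n] (pr x) := by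
    intro n; induction n with
    | zero => simp
    | succ k ih => intro x; rw [Function.iterate_succ_apply, Function.iterate_succ_apply, ih, hfac]
  have P : ∀ k : κ × κ', (fun x => (c x, c' (T^[n] x))) ⁻¹' {k}
      = c ⁻¹' {k.1} ∩ T^[n] ⁻¹' (c' ⁻¹' {k.2}) := by
    intro k; ext x; simp [Prod.ext_iff]
  refine ⟨κ × κ', inferInstance, fun k y => l k.1 y + l' k.2 (R^[n] y),
    fun x => (c x, c' (T^[n] x)), ?_, ?_, ?_, ?_, ?_, ?_⟩
  · exact fun k => (hl k.1).add ((hl' k.2).comp (hR.iterate n))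
  · exact ⟨C + C', fun k y => (abs_add_le _ _).trans (add_le_add (hC _ _) (hC' _ _))⟩
  · intro y
    simp only [Real.exp_add]
    rw [Fintype.sum_prod_type]
    simp only [← Finset.mul_sum, ← Finset.sum_mul]
    have := hs' (R^[n] y)
    calc _ ≤ (1:ℝ) * 1 := mul_le_mul (hs y) this
              (Finset.sum_nonneg fun _ _ => Real.exp_nonneg _) zero_le_one
      _ = 1 := one_mul 1
  · intro k
    rw [P]
    exact (hc _).inter (hT.iterate n (hc' _))
  · intro k
    rw [P]
    obtain ⟨B, hB, h1⟩ := hW k.1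
    obtain ⟨B', hB', h2⟩ := hW' k.2
    obtain ⟨f, hf, rfl⟩ := mem_coverIt.1 hB
    obtain ⟨f', hf', rfl⟩ := mem_coverIt.1 hB'
    refine ⟨_, mem_coverIt.2 ⟨fun i => if i ∈ S₁ then f i else f' (i - n), ?_, rfl⟩, ?_⟩
    · intro i hi
      by_cases h : i ∈ S₁
      · simp [h, hf i h]
      · simp only [h, if_false]
        exact hf' _ ((hS i hi).resolve_left h).2
    · rintro x ⟨hx1, hx2⟩ i hi
      by_cases h : i ∈ S₁
      · simp only [h, if_true]; exact h1 hx1 i h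
      · simp only [h, if_false]
        obtain ⟨hn, hi2⟩ := (hS i hi).resolve_left h
        have := h2 hx2 _ hi2
        rwa [← Function.iterate_add_apply, Nat.sub_add_cancel hn] at this
  · intro x
    simp only [hφ, hφ', hfacn]; ring

end

section
variable {X : Type u} {Y : Type v} [MeasurableSpace X]

lemma sel {ι : Type*} [Fintype ι] (P : ι → Set X) (hP : ∀ i, MeasurableSet (P i))
    (hcov : ∀ x, ∃ i, x ∈ P i) (f : ι → X → ℝ) (hf : ∀ i, Measurable (f i)) :
    ∃ c : X → ι, (∀ i, MeasurableSet (c ⁻¹' {i})) ∧ (∀ x, x ∈ P (c x)) ∧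
      ∀ x i, x ∈ P i → f i x ≤ f (c x) x := by
  classical
  let e := Fintype.equivFin ι
  let G : ι → Set X := fun i => P i ∩ ⋂ j, ((P j)ᶜ ∪ {x | f j x ≤ f i x})
  have hG : ∀ i, MeasurableSet (G i) := fun i => (hP i).inter
    (MeasurableSet.iInter fun j => (hP j).compl.union (measurableSet_le (hf j) (hf i)))
  have hGmem : ∀ i x, x ∈ G i ↔ x ∈ P i ∧ ∀ j, x ∈ P j → f j x ≤ f i x := by
    intro i x
    simp only [G, mem_inter_iff, mem_iInter, mem_union, mem_compl_iff, mem_ofPred_eq, imp_iff_not_or]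
  have hGc : ∀ x, ∃ i, x ∈ G i := by
    intro x
    obtain ⟨i0, hi0⟩ := hcov x
    obtain ⟨i, hi, hmax⟩ := Finset.exists_max_image (Finset.univ.filter fun i => x ∈ P i)
      (fun i => f i x) ⟨i0, by simp [hi0]⟩
    refine ⟨i, (hGmem i x).2 ⟨by simpa using hi, fun j hj => hmax j (by simp [hj])⟩⟩
  let p : X → ℕ → Prop := fun x N => ∃ h : N < Fintype.card ι, x ∈ G (e.symm ⟨N, h⟩)
  have hp : ∀ x, ∃ N, p x N := by
    intro x
    obtain ⟨i, hi⟩ := hGc x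
    exact ⟨e i, (e i).2, by simpa using hi⟩
  have hpm : ∀ N, MeasurableSet {x | p x N} := by
    intro N
    by_cases h : N < Fintype.card ι
    · have : {x | p x N} = G (e.symm ⟨N, h⟩) := by ext x; simp [p, h]
      rw [this]; exact hG _
    · have : {x | p x N} = ∅ := by ext x; simp [p, h]
      rw [this]; exact MeasurableSet.empty
  have hm := measurable_find hp hpm
  refine ⟨fun x => e.symm ⟨Nat.find (hp x), (Nat.find_spec (hp x)).1⟩, ?_, ?_, ?_⟩
  · intro i
    have : (fun x => e.symm ⟨Nat.find (hp x), (Nat.find_spec (hp x)).1⟩) ⁻¹' {i}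
        = (fun x => Nat.find (hp x)) ⁻¹' {((e i : Fin _) : ℕ)} := by
      ext x
      simp only [mem_preimage, mem_singleton_iff, Equiv.symm_apply_eq, Fin.ext_iff]
    rw [this]
    exact hm (measurableSet_singleton _)
  · intro x
    exact ((hGmem _ x).1 (Nat.find_spec (hp x)).2).1
  · intro x i hi
    exact ((hGmem _ x).1 (Nat.find_spec (hp x)).2).2 i hi

variable [MetricSpace Y] [CompactSpace Y] [MeasurableSpace Y] [BorelSpace Y]
  {pr : X → Y} {W : Finset (Set X)}

lemma lse_le {ι : Type*} [Fintype ι] [Nonempty ι] (g d : ι → ℝ) (D : ℝ)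
    (h : ∀ i, |d i - g i| ≤ D) :
    Real.log (∑ i, Real.exp (d i)) ≤ Real.log (∑ i, Real.exp (g i)) + D := by
  have hZ : 0 < ∑ i, Real.exp (g i) :=
    Finset.sum_pos (fun i _ => Real.exp_pos _) Finset.univ_nonempty
  have hZ' : 0 < ∑ i, Real.exp (d i) :=
    Finset.sum_pos (fun i _ => Real.exp_pos _) Finset.univ_nonempty
  have : ∑ i, Real.exp (d i) ≤ (∑ i, Real.exp (g i)) * Real.exp D := by
    rw [Finset.sum_mul]
    refine Finset.sum_le_sum fun i _ => ?_
    rw [← Real.exp_add]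
    exact Real.exp_le_exp.2 (by linarith [le_of_abs_le (h i)])
  calc _ ≤ Real.log ((∑ i, Real.exp (g i)) * Real.exp D) := Real.log_le_log hZ' this
    _ = _ := by rw [Real.log_mul hZ.ne' (Real.exp_pos _).ne', Real.log_exp]

lemma code_of_cont (hpr : Measurable pr) (hWm : ∀ A ∈ W, MeasurableSet A) (hWc : IsCover W)
    (d : W → C(Y, ℝ)) : ∃ φ, IsCode pr W φ ∧ ∀ (x : X) (w : W), x ∈ w.1 →
      φ x ≤ Real.log (∑ i, Real.exp (d i (pr x))) - d w (pr x) := by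
  obtain ⟨c, hc1, hc2, hc3⟩ := sel (fun w : W => w.1) (fun w => hWm _ w.2) (by
    intro x
    have : x ∈ ⋃₀ (W : Set (Set X)) := by rw [hWc]; trivial
    obtain ⟨B, hB, hx⟩ := this
    exact ⟨⟨B, hB⟩, hx⟩) (fun w x => d w (pr x)) (fun w => (d w).continuous.measurable.comp hpr)
  have hcont : ∀ w : W, Continuous fun y => d w y - Real.log (∑ i, Real.exp (d i y)) := by
    intro w
    have : Nonempty W := ⟨w⟩
    refine (d w).continuous.sub (Continuous.log ?_ fun y => ?_)
    · exact continuous_finsetSum _ fun i _ => Real.continuous_exp.comp (d i).continuous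
    · exact (Finset.sum_pos (fun i _ => Real.exp_pos _) Finset.univ_nonempty).ne'
  refine ⟨fun x => -(d (c x) (pr x) - Real.log (∑ i, Real.exp (d i (pr x)))),
    ⟨W, inferInstance, fun w y => d w y - Real.log (∑ i, Real.exp (d i y)), c, ?_, ?_, ?_, hc1, ?_,
      fun x => rfl⟩, ?_⟩
  · exact fun w => (hcont w).measurable
  · have : ∀ w : W, ∃ C, ∀ y, |d w y - Real.log (∑ i, Real.exp (d i y))| ≤ C := by
      intro w
      obtain ⟨C, hC⟩ := isCompact_univ.exists_bound_of_continuousOn (hcont w).continuousOn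
      exact ⟨C, fun y => hC y trivial⟩
    choose C hC using this
    obtain ⟨M, hM⟩ := Finite.exists_le C
    exact ⟨M, fun k y => (hC k y).trans (hM k)⟩
  · intro y
    rcases isEmpty_or_nonempty W with h | h
    · simp
    · have hZ : 0 < ∑ i, Real.exp (d i y) :=
        Finset.sum_pos (fun i _ => Real.exp_pos _) Finset.univ_nonempty
      simp only [Real.exp_sub, Real.exp_log hZ, ← Finset.sum_div]
      rw [div_self hZ.ne']
  · intro w
    refine ⟨w.1, w.2, ?_⟩
    intro x hx
    have h := hc2 x
    rwa [show c x = w from hx] at h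
  · intro x w hw
    have := hc3 x w hw
    simp only at this ⊢
    linarith

lemma approx (ν : Measure X) [IsProbabilityMeasure ν] (hpr : Measurable pr) (g : Y → ℝ)
    (hg : Measurable g) (C : ℝ) (hC : ∀ y, |g y| ≤ C) (d : ℕ → C(Y, ℝ)) (hd : DenseRange d)
    {η : ℝ} (hη : 0 < η) : ∃ n, ∫ x, |d n (pr x) - g (pr x)| ∂ν ≤ η := by
  have : IsProbabilityMeasure (ν.map pr) := Measure.isProbabilityMeasure_map hpr.aemeasurable
  have hgi : Integrable g (ν.map pr) :=
    Integrable.of_bound hg.aestronglyMeasurable C (Eventually.of_forall hC)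
  obtain ⟨f, hf, hfi⟩ := hgi.exists_boundedContinuous_integral_sub_le (half_pos hη)
  obtain ⟨n, hn⟩ := hd.exists_dist_lt f.toContinuousMap (half_pos hη)
  refine ⟨n, ?_⟩
  have hm : Measurable fun y => |d n y - g y| := ((d n).continuous.measurable.sub hg).abs
  rw [← integral_map (φ := pr) (f := fun y => |d n y - g y|) hpr.aemeasurable
    hm.aestronglyMeasurable]
  have hfg : Integrable (fun y => ‖g y - f y‖) (ν.map pr) := (hgi.sub hfi).norm
  have hle : ∀ y, |d n y - g y| ≤ ‖g y - f y‖ + η / 2 := by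
    intro y
    have h1 := ContinuousMap.dist_apply_le_dist (f := f.toContinuousMap) (g := d n) y
    rw [Real.dist_eq] at h1
    have h2 : |f y - d n y| ≤ η / 2 := (h1.trans hn.le)
    rw [Real.norm_eq_abs]
    rw [abs_sub_comm] at h2
    have : d n y - g y = (d n y - f y) - (g y - f y) := by ring
    rw [this]
    linarith [abs_sub (d n y - f y) (g y - f y)]
  calc _ ≤ ∫ y, (‖g y - f y‖ + η / 2) ∂(ν.map pr) :=
        integral_mono_of_nonneg (Eventually.of_forall fun y => abs_nonneg _)
          (hfg.add (integrable_const _)) (Eventually.of_forall hle)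
    _ = ∫ y, ‖g y - f y‖ ∂(ν.map pr) + η / 2 := by
        rw [integral_add hfg (integrable_const _)]; simp
    _ ≤ η := by linarith

lemma part_code (ν : Measure X) [IsProbabilityMeasure ν] (hpr : Measurable pr)
    {α : Finset (Set X)} (hα : IsMPartition α) (hr : Refines α W)
    (d : ℕ → C(Y, ℝ)) (hd : DenseRange d) {η : ℝ} (hη : 0 < η)
    (Φ : (W → ℕ) → X → ℝ) (hΦ : ∀ n, IsCode pr W (Φ n))
    (hΦ' : ∀ n (x : X) (w : W), x ∈ w.1 →
      Φ n x ≤ Real.log (∑ i, Real.exp (d (n i) (pr x))) - d (n w) (pr x)) :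
    ∃ n, ∫ x, Φ n x ∂ν ≤ condEntPart ν pr α + 3 * (W.card * η) := by
  classical
  have hex : ∀ x, ∃ a : α, x ∈ a.1 := by
    intro x
    have : x ∈ ⋃₀ (α : Set (Set X)) := by rw [hα.1]; trivial
    obtain ⟨B, hB, hx⟩ := this
    exact ⟨⟨B, hB⟩, hx⟩
  choose c hc using hex
  have hca : ∀ a : α, c ⁻¹' {a} = a.1 := by
    intro a; ext x
    constructor
    · intro h; have := hc x; rwa [show c x = a from h] at this
    · intro h
      by_contra hne
      have hne' : (c x).1 ≠ a.1 := fun h' => hne (Subtype.ext h')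
      exact Set.disjoint_left.1 (hα.2.2 _ (c x).2 _ a.2 hne') (hc x) h
  have hrr : ∀ a : α, ∃ w : W, a.1 ⊆ w.1 := fun a => by
    obtain ⟨B, hB, h⟩ := hr a.1 a.2; exact ⟨⟨B, hB⟩, h⟩
  choose e he using hrr
  choose h hm h0 h1 hH hf using fun a : α => cp_facts ν hpr (hα.2.1 a.1 a.2)
  let s : W → Y → ℝ := fun w y => (∑ a, if e a = w then h a y else 0) + η
  have hs0 : ∀ w y, η ≤ s w y := fun w y => by
    have : 0 ≤ ∑ a, if e a = w then h a y else 0 := Finset.sum_nonneg fun a _ => by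
      split_ifs; exacts [h0 _ _, le_rfl]
    simp only [s]; linarith
  have hs1 : ∀ w y, s w y ≤ Fintype.card α + η := fun w y => by
    have : (∑ a, if e a = w then h a y else 0) ≤ ∑ a : α, (1:ℝ) := Finset.sum_le_sum fun a _ => by
      split_ifs; exacts [h1 _ _, zero_le_one]
    rw [Finset.sum_const, Finset.card_univ, nsmul_eq_mul, mul_one] at this
    simp only [s]; linarith
  have hsp : ∀ w y, 0 < s w y := fun w y => hη.trans_le (hs0 w y)
  have hsm : ∀ w, Measurable (s w) := fun w => by
    refine Measurable.add_const (Finset.measurable_sum _ fun a _ => ?_) _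
    split_ifs
    exacts [hm a, measurable_const]
  have hsa : ∀ a y, h a y ≤ s (e a) y := fun a y => by
    have : (if e a = e a then h a y else 0) ≤ ∑ b, if e b = e a then h b y else 0 :=
      Finset.single_le_sum (f := fun b => if e b = e a then h b y else 0)
        (fun b _ => by split_ifs; exacts [h0 _ _, le_rfl]) (Finset.mem_univ a)
    simp only [if_true] at this
    simp only [s]; linarith
  have hssum : ∀ y, ∑ w, s w y = ∑ a, h a y + W.card * η := fun y => by
    simp only [s, Finset.sum_add_distrib]
    rw [Finset.sum_comm]
    simp
  have hgm : ∀ w, Measurable fun y => Real.log (s w y) := fun w => (hsm w).log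
  have hgb : ∃ C, ∀ w y, |Real.log (s w y)| ≤ C := by
    refine ⟨|Real.log η| + |Real.log (Fintype.card α + η)|, fun w y => ?_⟩
    have a1 := Real.log_le_log hη (hs0 w y)
    have a2 := Real.log_le_log (hsp w y) (hs1 w y)
    rw [abs_le]
    constructor
    · linarith [neg_abs_le (Real.log η), abs_nonneg (Real.log (Fintype.card α + η))]
    · linarith [le_abs_self (Real.log (Fintype.card α + η)), abs_nonneg (Real.log η)]
  obtain ⟨C, hC⟩ := hgb
  choose n hn using fun w : W => approx ν hpr _ (hgm w) C (hC w) d hd hη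
  refine ⟨n, ?_⟩
  let D : X → ℝ := fun x => ∑ w : W, |d (n w) (pr x) - Real.log (s w (pr x))|
  let Q : X → ℝ := fun x => ∑ a : α, (a.1).indicator (fun x => -Real.log (s (e a) (pr x))) x
  have hpt : ∀ x, Φ n x ≤ (∑ a, h a (pr x) + (W.card * η - 1)) + Q x + 2 * D x := by
    intro x
    have : Nonempty W := ⟨e (c x)⟩
    have hx : x ∈ (e (c x)).1 := he _ (hc x)
    have b1 := hΦ' n x (e (c x)) hx
    have hDw : ∀ w, |d (n w) (pr x) - Real.log (s w (pr x))| ≤ D x := fun w =>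
      Finset.single_le_sum (f := fun w : W => |d (n w) (pr x) - Real.log (s w (pr x))|)
        (fun _ _ => abs_nonneg _) (Finset.mem_univ w)
    have b2 := lse_le (fun w => Real.log (s w (pr x))) (fun w => d (n w) (pr x)) (D x) hDw
    have b3 := neg_le_of_abs_le (hDw (e (c x)))
    have b4 : Real.log (∑ w, Real.exp (Real.log (s w (pr x)))) ≤
        ∑ a, h a (pr x) + (W.card * η - 1) := by
      simp only [fun w => Real.exp_log (hsp w (pr x))]
      have := Real.log_le_sub_one_of_pos
        (Finset.sum_pos (fun w _ => hsp w (pr x)) (Finset.univ_nonempty (α := W)))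
      rw [hssum] at this ⊢
      linarith
    have b5 : Q x = -Real.log (s (e (c x)) (pr x)) := by
      have := sum_ind c (fun a x => -Real.log (s (e a) (pr x))) x
      simp only [hca] at this
      exact this.symm
    rw [b5]; linarith
  have I1 : ∀ a, Integrable (fun x => h a (pr x)) ν := fun k =>
    Integrable.of_bound ((hm k).comp hpr).aestronglyMeasurable 1
      (Eventually.of_forall fun x => by
        rw [Real.norm_eq_abs, abs_of_nonneg (h0 _ _)]; exact h1 _ _)
  have Ig : ∀ w, Integrable (fun x => Real.log (s w (pr x))) ν := fun w =>
    Integrable.of_bound ((hgm w).comp hpr).aestronglyMeasurable C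
      (Eventually.of_forall fun x => hC _ _)
  have Id : ∀ k, Integrable (fun x => d k (pr x)) ν := fun k => by
    obtain ⟨M, hM⟩ := isCompact_univ.exists_bound_of_continuousOn (d k).continuous.continuousOn
    exact Integrable.of_bound ((d k).continuous.measurable.comp hpr).aestronglyMeasurable M
      (Eventually.of_forall fun x => hM _ trivial)
  have ID : Integrable D ν := integrable_finsetSum _ fun w _ => ((Id _).sub (Ig w)).abs
  have IQ' : ∀ a : α, Integrable ((a.1).indicator (fun x => -Real.log (s (e a) (pr x)))) ν :=
    fun a => (Ig (e a)).neg.indicator (hα.2.1 _ a.2)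
  have IQ : Integrable Q ν := integrable_finsetSum _ fun a _ => IQ' a
  have IS : Integrable (fun x => ∑ a, h a (pr x)) ν := integrable_finsetSum _ fun a _ => I1 a
  have IS' : Integrable (fun x => ∑ a, h a (pr x) + (W.card * η - 1)) ν :=
    IS.add (integrable_const _)
  have V1 : ∫ x, ∑ a, h a (pr x) ∂ν = 1 := by
    rw [integral_finsetSum _ fun a _ => I1 a]
    have : ∀ a : α, ∫ x, h a (pr x) ∂ν = ∫ x, (c ⁻¹' {a}).indicator (fun _ => (1:ℝ)) x ∂ν := by
      intro a
      have := hf a (fun _ => 1) measurable_const ⟨1, by simp⟩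
      rw [hca]
      simpa using this
    simp_rw [this]
    rw [← integral_finsetSum _ (fun a _ => (integrable_const 1).indicator
      (by rw [hca]; exact hα.2.1 _ a.2))]
    have : ∀ x, ∑ k, (c ⁻¹' {k}).indicator (fun _ => (1:ℝ)) x = 1 := fun x =>
      (sum_ind c (fun _ _ => (1:ℝ)) x).symm
    simp only [this]; simp
  have V2 : ∫ x, Q x ∂ν ≤ condEntPart ν pr α := by
    simp only [Q]
    rw [integral_finsetSum _ fun a _ => IQ' a, condEntPart, ← Finset.sum_coe_sort α]
    refine Finset.sum_le_sum fun a _ => ?_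
    rw [hH a, ← hf a (fun y => -Real.log (s (e a) y)) (hgm _).neg
      ⟨C, fun y => by rw [abs_neg]; exact hC _ _⟩]
    refine integral_mono ?_ ?_ ?_
    · refine Integrable.of_bound (((hm a).comp hpr).mul
        ((hgm (e a)).comp hpr).neg).aestronglyMeasurable C (Eventually.of_forall fun x => ?_)
      rw [Real.norm_eq_abs, abs_mul, abs_of_nonneg (h0 _ _), abs_neg]
      calc _ ≤ 1 * C := mul_le_mul (h1 _ _) (hC _ _) (abs_nonneg _) zero_le_one
        _ = C := one_mul _
    · refine Integrable.of_bound (Real.continuous_negMulLog.measurable.comp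
        ((hm a).comp hpr)).aestronglyMeasurable 1 (Eventually.of_forall fun x => ?_)
      rw [Real.norm_eq_abs, abs_of_nonneg (Real.negMulLog_nonneg (h0 _ _) (h1 _ _))]
      have := negMulLog_le (l := 0) (h0 a (pr x))
      have := h0 a (pr x)
      simp at *; linarith
    · intro x
      simp only [Real.negMulLog]
      rcases (h0 a (pr x)).eq_or_lt with hz | hz
      · rw [← hz]; simp
      · have := Real.log_le_log hz (hsa a (pr x))
        nlinarith
  have V3 : ∫ x, D x ∂ν ≤ W.card * η := by
    simp only [D]
    rw [integral_finsetSum Finset.univ (f := fun w x => |d (n w) (pr x) - Real.log (s w (pr x))|)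
      fun w _ => ((Id (n w)).sub (Ig w)).abs]
    calc _ ≤ ∑ w : W, η := Finset.sum_le_sum fun w _ => hn w
      _ = _ := by simp
  have hIle := integral_mono ((hΦ n).int hpr ν) ((IS'.add IQ).add (ID.const_mul 2)) hpt
  have e1 := integral_add (IS'.add IQ) (ID.const_mul 2)
  have e2 := integral_add IS' IQ
  have e3 := integral_add IS (integrable_const (μ := ν) ((W.card * η - 1 : ℝ)))
  simp only [Pi.add_apply] at e1 e2 e3 hIle
  rw [e1, e2, e3, integral_const_mul, V1] at hIle
  simp at hIle
  linarith

lemma dense_codes (hpr : Measurable pr) (hWm : ∀ A ∈ W, MeasurableSet A) (hWc : IsCover W) :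
    ∃ Φ : (W → ℕ) → X → ℝ, (∀ n, IsCode pr W (Φ n)) ∧
      ∀ (ν : Measure X) [IsProbabilityMeasure ν] (ε : ℝ), 0 < ε →
        ∃ n, ∫ x, Φ n x ∂ν ≤ condEntCover ν pr W + ε := by
  let d : ℕ → C(Y, ℝ) := TopologicalSpace.denseSeq C(Y, ℝ)
  have hd : DenseRange d := TopologicalSpace.denseRange_denseSeq _
  choose Φ hΦ hΦ' using fun n : W → ℕ => code_of_cont hpr hWm hWc (fun w => d (n w))
  refine ⟨Φ, hΦ, fun ν _ ε hε => ?_⟩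
  have hne : {h | ∃ α, IsMPartition (X := X) α ∧ Refines α W ∧ h = condEntPart ν pr α}.Nonempty := by
    obtain ⟨α, h1, h2, -⟩ := (hΦ fun _ => 0).part ν hpr
    exact ⟨_, α, h1, h2, rfl⟩
  obtain ⟨_, ⟨α, h1, h2, rfl⟩, h3⟩ := exists_lt_of_csInf_lt hne
    (show sInf _ < condEntCover ν pr W + ε / 2 from lt_add_of_pos_right _ (half_pos hε))
  have hpos : (0:ℝ) < 6 * (W.card + 1) := by positivity
  obtain ⟨n, hn⟩ := part_code ν hpr h1 h2 d hd (η := ε / (6 * (W.card + 1))) (div_pos hε hpos) Φ hΦ hΦ'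
  refine ⟨n, hn.trans ?_⟩
  have : 3 * (W.card * (ε / (6 * (W.card + 1)))) ≤ ε / 2 := by
    rw [← mul_div_assoc, ← mul_div_assoc, div_le_iff₀ hpos]
    nlinarith
  linarith

end


section three

variable {X : Type u} {Y : Type v} [MeasurableSpace X]
variable [MetricSpace Y] [CompactSpace Y] [MeasurableSpace Y] [BorelSpace Y]
variable {pr : X → Y} {T : X → X} {R : Y → Y} {U : Finset (Set X)}

def Codes (pr : X → Y) (T : X → X) (U : Finset (Set X)) (n : ℕ) (Φ : Finset ℕ → X → ℝ) : Prop :=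
  ∀ S ∈ (Finset.range n).powerset, IsCode pr (coverIt T U S) (Φ S)

def val (n : ℕ) (Φ : Finset ℕ → X → ℝ) (ν : Measure X) : ℝ :=
  ∑ S ∈ (Finset.range n).powerset, ((1 : ℝ) / 2) ^ n * ∫ x, Φ S x ∂ν

def aa (pr : X → Y) (T : X → X) (U : Finset (Set X)) (ν : Measure X) (n : ℕ) : ℝ :=
  ∑ S ∈ (Finset.range n).powerset, ((1 : ℝ) / 2) ^ n * condEntCover ν pr (coverIt T U S)

lemma sum_pow (n : ℕ) (c : ℝ) :
    ∑ _S ∈ (Finset.range n).powerset, ((1 : ℝ) / 2) ^ n * c = c := by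
  simp [Finset.card_powerset]

lemma coverIt_meas (hT : Measurable T) (hUm : ∀ A ∈ U, MeasurableSet A) (S : Finset ℕ) :
    ∀ A ∈ coverIt T U S, MeasurableSet A := by
  intro A hA
  obtain ⟨f, hf, rfl⟩ := mem_coverIt.1 hA
  have : {x | ∀ i ∈ S, T^[i] x ∈ f i} = ⋂ i ∈ S, (T^[i]) ⁻¹' f i := by ext; simp
  rw [this]
  exact Finset.measurableSet_biInter _ fun i hi => (hT.iterate i) (hUm _ (hf i hi))

lemma coverIt_cover (hUc : IsCover U) (S : Finset ℕ) : IsCover (coverIt T U S) := by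
  refine Set.eq_univ_of_forall fun x => ?_
  have : ∀ i, ∃ A ∈ U, T^[i] x ∈ A := fun i => by
    have h : T^[i] x ∈ ⋃₀ (U : Set (Set X)) := by rw [hUc]; trivial
    simpa using h
  choose f hf hf' using this
  exact ⟨_, Finset.mem_coe.2 (mem_coverIt.2 ⟨f, fun i _ => hf i, rfl⟩), fun i _ => hf' i⟩

lemma aa_le {n : ℕ} {Φ : Finset ℕ → X → ℝ} (hpr : Measurable pr) (h : Codes pr T U n Φ)
    (ν : Measure X) [IsProbabilityMeasure ν] : aa pr T U ν n ≤ val n Φ ν :=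
  Finset.sum_le_sum fun S hS => mul_le_mul_of_nonneg_left ((h S hS).le ν hpr) (by positivity)

lemma aa_nonneg (hpr : Measurable pr) (ν : Measure X) [IsProbabilityMeasure ν] (n : ℕ) :
    0 ≤ aa pr T U ν n :=
  Finset.sum_nonneg fun S hS => mul_nonneg (by positivity) (condEntCover_nonneg ν hpr)

lemma val_bdd {n : ℕ} {Φ : Finset ℕ → X → ℝ} (h : Codes pr T U n Φ) :
    ∃ C, ∀ (ν : Measure X) [IsProbabilityMeasure ν], |val n Φ ν| ≤ C := by
  have : ∀ S, ∃ C, S ∈ (Finset.range n).powerset → ∀ x, |Φ S x| ≤ C := fun S => by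
    by_cases hS : S ∈ (Finset.range n).powerset
    · obtain ⟨C, hC⟩ := (h S hS).bdd
      exact ⟨C, fun _ => hC⟩
    · exact ⟨0, fun h => absurd h hS⟩
  choose C hC using this
  refine ⟨∑ S ∈ (Finset.range n).powerset, ((1 : ℝ) / 2) ^ n * C S, fun ν _ => ?_⟩
  refine (Finset.abs_sum_le_sum_abs _ _).trans (Finset.sum_le_sum fun S hS => ?_)
  rw [abs_mul, abs_of_nonneg (by positivity : (0:ℝ) ≤ (1/2)^n)]
  refine mul_le_mul_of_nonneg_left ?_ (by positivity)
  have := norm_integral_le_of_norm_le_const (μ := ν) (f := Φ S) (C := C S)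
    (Eventually.of_forall fun x => hC S hS x)
  simpa using this

lemma sum_split (n m : ℕ) (H : Finset ℕ → Finset ℕ → ℝ) :
    ∑ S ∈ (Finset.range (n + m)).powerset,
      H (S.filter (· < n)) ((S.filter (n ≤ ·)).image (· - n)) =
    ∑ A ∈ (Finset.range n).powerset, ∑ B ∈ (Finset.range m).powerset, H A B := by
  rw [← Finset.sum_product']
  refine Finset.sum_nbij' (fun S => (S.filter (· < n), (S.filter (n ≤ ·)).image (· - n)))
    (fun p => p.1 ∪ p.2.image (· + n)) ?_ ?_ ?_ ?_ ?_
  · intro S hS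
    simp only [Finset.mem_product, Finset.mem_powerset, Finset.subset_iff, Finset.mem_filter,
      Finset.mem_range, Finset.mem_image] at hS ⊢
    refine ⟨fun x hx => hx.2, ?_⟩
    rintro x ⟨y, ⟨hy, hy'⟩, rfl⟩
    have := hS hy
    omega
  · rintro ⟨A, B⟩ hS
    simp only [Finset.mem_product, Finset.mem_powerset, Finset.subset_iff, Finset.mem_union,
      Finset.mem_range, Finset.mem_image] at hS ⊢
    rintro x (hx | ⟨y, hy, rfl⟩)
    · have := hS.1 hx; omega
    · have := hS.2 hy; omega
  · intro S hS
    ext x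
    simp only [Finset.mem_filter, Finset.mem_union, Finset.mem_image]
    constructor
    · rintro (hx | ⟨y, ⟨z, ⟨hz, hz'⟩, rfl⟩, rfl⟩)
      · exact hx.1
      · rwa [Nat.sub_add_cancel hz']
    · intro hx
      rcases lt_or_ge x n with h | h
      · exact Or.inl ⟨hx, h⟩
      · exact Or.inr ⟨x - n, ⟨x, ⟨hx, h⟩, rfl⟩, by omega⟩
  · rintro ⟨A, B⟩ hS
    simp only [Finset.mem_product, Finset.mem_powerset, Finset.subset_iff,
      Finset.mem_range] at hS
    simp only [Prod.mk.injEq]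
    constructor
    · ext x
      simp only [Finset.mem_filter, Finset.mem_union, Finset.mem_image]
      constructor
      · rintro ⟨hx | ⟨y, hy, rfl⟩, h⟩
        · exact hx
        · omega
      · intro hx
        exact ⟨Or.inl hx, hS.1 hx⟩
    · ext x
      simp only [Finset.mem_filter, Finset.mem_union, Finset.mem_image]
      constructor
      · rintro ⟨y, ⟨hy | ⟨z, hz, rfl⟩, h⟩, rfl⟩
        · have := hS.1 hy; omega
        · simpa using hz
      · intro hx
        exact ⟨x + n, ⟨Or.inr ⟨x, hx, rfl⟩, by omega⟩, by omega⟩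
  · intro S hS
    rfl

lemma codes_add (hpr : Measurable pr) (hT : Measurable T) (hR : Measurable R)
    (hfac : ∀ x, pr (T x) = R (pr x)) {n m : ℕ} {Φ Ψ : Finset ℕ → X → ℝ}
    (h : Codes pr T U n Φ) (h' : Codes pr T U m Ψ) :
    ∃ Θ, Codes pr T U (n + m) Θ ∧ ∀ (ν : Measure X) [IsProbabilityMeasure ν],
      Measure.map T ν = ν → val (n + m) Θ ν ≤ val n Φ ν + val m Ψ ν := by
  have hlo : ∀ S ∈ (Finset.range (n + m)).powerset,
      S.filter (· < n) ∈ (Finset.range n).powerset := by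
    intro S hS
    simp only [Finset.mem_powerset, Finset.subset_iff, Finset.mem_filter, Finset.mem_range]
    exact fun x hx => hx.2
  have hhi : ∀ S ∈ (Finset.range (n + m)).powerset,
      (S.filter (n ≤ ·)).image (· - n) ∈ (Finset.range m).powerset := by
    intro S hS
    simp only [Finset.mem_powerset, Finset.subset_iff, Finset.mem_filter,
      Finset.mem_range, Finset.mem_image] at hS ⊢
    rintro x ⟨y, ⟨hy, hy'⟩, rfl⟩
    have := hS hy
    omega
  refine ⟨fun S x => Φ (S.filter (· < n)) x + Ψ ((S.filter (n ≤ ·)).image (· - n)) (T^[n] x),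
    fun S hS => ?_, fun ν _ hν => ?_⟩
  · refine IsCode.join hT hR hfac ?_ (h _ (hlo S hS)) (h' _ (hhi S hS))
    intro i hi
    rcases lt_or_ge i n with h | h
    · exact Or.inl (Finset.mem_filter.2 ⟨hi, h⟩)
    · exact Or.inr ⟨h, Finset.mem_image.2 ⟨i, Finset.mem_filter.2 ⟨hi, h⟩, rfl⟩⟩
  · have hmp : MeasurePreserving (T^[n]) ν ν := (MeasurePreserving.mk hT hν).iterate n
    have hI : ∀ B ∈ (Finset.range m).powerset,
        Integrable (fun x => Ψ B (T^[n] x)) ν ∧ ∫ x, Ψ B (T^[n] x) ∂ν = ∫ x, Ψ B x ∂ν := by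
      intro B hB
      have i1 := (h' B hB).int hpr ν
      refine ⟨hmp.integrable_comp_of_integrable i1, ?_⟩
      have := integral_map (μ := ν) hmp.measurable.aemeasurable (f := Ψ B)
        (((h' B hB).meas hpr).aestronglyMeasurable)
      rw [← this, hmp.map_eq]
    have : val (n + m) (fun S x => Φ (S.filter (· < n)) x +
        Ψ ((S.filter (n ≤ ·)).image (· - n)) (T^[n] x)) ν =
        ∑ S ∈ (Finset.range (n + m)).powerset, (fun A B => ((1:ℝ)/2)^n * (((1:ℝ)/2)^m *
          (∫ x, Φ A x ∂ν)) + ((1:ℝ)/2)^n * (((1:ℝ)/2)^m * ∫ x, Ψ B x ∂ν))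
        (S.filter (· < n)) ((S.filter (n ≤ ·)).image (· - n)) := by
      refine Finset.sum_congr rfl fun S hS => ?_
      rw [integral_add ((h _ (hlo S hS)).int hpr ν) (hI _ (hhi S hS)).1, (hI _ (hhi S hS)).2]
      ring
    have this := this.trans (sum_split n m (fun A B => ((1:ℝ)/2)^n * (((1:ℝ)/2)^m *
          (∫ x, Φ A x ∂ν)) + ((1:ℝ)/2)^n * (((1:ℝ)/2)^m * ∫ x, Ψ B x ∂ν)))
    rw [this]
    simp only [Finset.sum_add_distrib]
    refine le_of_eq ?_
    congr 1
    · refine Finset.sum_congr rfl fun A _ => ?_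
      rw [← Finset.mul_sum, sum_pow]
    · rw [Finset.sum_comm]
      refine Finset.sum_congr rfl fun B _ => ?_
      rw [sum_pow]

lemma codes_mul (hpr : Measurable pr) (hT : Measurable T) (hR : Measurable R)
    (hfac : ∀ x, pr (T x) = R (pr x)) {n : ℕ} {Φ : Finset ℕ → X → ℝ}
    (h : Codes pr T U n Φ) (j : ℕ) :
    ∃ Θ, Codes pr T U ((j + 1) * n) Θ ∧ ∀ (ν : Measure X) [IsProbabilityMeasure ν],
      Measure.map T ν = ν → val ((j + 1) * n) Θ ν ≤ (j + 1) * val n Φ ν := by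
  induction j with
  | zero => exact ⟨Φ, by simpa using h, fun ν _ _ => by simp⟩
  | succ j ih =>
    obtain ⟨Θ, h1, h2⟩ := ih
    obtain ⟨Ξ, h3, h4⟩ := codes_add hpr hT hR hfac h1 h
    have e : (j + 1) * n + n = (j + 1 + 1) * n := by ring
    rw [e] at h3
    refine ⟨Ξ, h3, fun ν _ hν => ?_⟩
    have h5 := h4 ν hν
    rw [e] at h5
    have := h2 ν hν
    push_cast
    linarith

def bmin (F : ℕ → ℝ) : ℕ → ℝ
  | 0 => F 0
  | K + 1 => min (bmin F K) (F (K + 1))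

lemma bmin_le (F : ℕ → ℝ) {k K : ℕ} (h : k ≤ K) : bmin F K ≤ F k := by
  induction K with
  | zero => obtain rfl : k = 0 := by omega
            exact le_rfl
  | succ K ih =>
    rcases Nat.lt_or_ge K k with h' | h'
    · obtain rfl : k = K + 1 := by omega
      exact min_le_right _ _
    · exact (min_le_left _ _).trans (ih h')

lemma le_bmin (F : ℕ → ℝ) {c : ℝ} (h : ∀ k, c ≤ F k) (K : ℕ) : c ≤ bmin F K := by
  induction K with
  | zero => exact h 0
  | succ K ih => exact le_min ih (h _)

lemma bmin_mono {F G : ℕ → ℝ} (h : ∀ k, F k ≤ G k) (K : ℕ) : bmin F K ≤ bmin G K := by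
  induction K with
  | zero => exact h 0
  | succ K ih => exact min_le_min ih (h _)

lemma bmin_mul {F : ℕ → ℝ} {c : ℝ} (hc : 0 ≤ c) (K : ℕ) :
    bmin (fun k => c * F k) K = c * bmin F K := by
  induction K with
  | zero => rfl
  | succ K ih => simp only [bmin, ih, mul_min_of_nonneg _ _ hc]

lemma bmin_tendsto {F : ℕ → ℝ} {c : ℝ} (h : ∀ k, c ≤ F k)
    (h' : ∀ ε > 0, ∃ k, F k ≤ c + ε) : Tendsto (bmin F) atTop (nhds c) := by
  rw [Metric.tendsto_atTop]
  intro ε hε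
  obtain ⟨k, hk⟩ := h' (ε / 2) (by positivity)
  refine ⟨k, fun K hK => ?_⟩
  have h1 := bmin_le F hK
  have h2 := le_bmin F h K
  rw [Real.dist_eq, abs_lt]
  constructor <;> linarith

lemma codes_mix (hpr : Measurable pr) {n : ℕ} {Φ : ℕ → Finset ℕ → X → ℝ}
    (h : ∀ k, Codes pr T U n (Φ k)) (K : ℕ) :
    ∃ Θ, Codes pr T U n Θ ∧ ∀ (ν : Measure X) [IsProbabilityMeasure ν],
      val n Θ ν ≤ bmin (fun k => val n (Φ k) ν) K + K * Real.log 2 := by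
  induction K with
  | zero => exact ⟨Φ 0, h 0, fun ν _ => by simp [bmin]⟩
  | succ K ih =>
    obtain ⟨Θ, h1, h2⟩ := ih
    refine ⟨fun S x => min (Θ S x) (Φ (K + 1) S x) + Real.log 2,
      fun S hS => (h1 S hS).mix hpr (h _ S hS), fun ν _ => ?_⟩
    have key : ∀ Ψ : Finset ℕ → X → ℝ, Codes pr T U n Ψ →
        (∀ S x, min (Θ S x) (Φ (K + 1) S x) ≤ Ψ S x) →
        val n (fun S x => min (Θ S x) (Φ (K + 1) S x) + Real.log 2) ν ≤
          val n Ψ ν + Real.log 2 := by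
      intro Ψ hΨ hle
      conv_rhs => rw [← sum_pow n (Real.log 2), val, ← Finset.sum_add_distrib]
      rw [val]
      refine Finset.sum_le_sum fun S hS => ?_
      rw [← mul_add]
      refine mul_le_mul_of_nonneg_left ?_ (by positivity)
      have hi := ((h1 S hS).mix hpr (h (K+1) S hS)).int hpr ν
      have := integral_mono hi (((hΨ S hS).int hpr ν).add (integrable_const (Real.log 2)))
        (fun x => by simpa using hle S x)
      have e := integral_add ((hΨ S hS).int hpr ν) (integrable_const (μ := ν) (Real.log 2))
      simp only [Pi.add_apply] at this
      rw [e] at this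
      simpa using this
    have k1 := key Θ h1 fun S x => min_le_left _ _
    have k2 := key _ (h (K + 1)) fun S x => min_le_right _ _
    have := h2 ν
    simp only [bmin]
    rw [← min_add_add_right]
    push_cast
    have hl : 0 ≤ Real.log 2 := Real.log_nonneg (by norm_num)
    have hK : (0:ℝ) ≤ K := K.cast_nonneg
    refine le_min (by linarith) (by nlinarith)

lemma codes_dense (hpr : Measurable pr) (hT : Measurable T)
    (hUc : IsCover U) (hUm : ∀ A ∈ U, MeasurableSet A) (n : ℕ) :
    ∃ Φ : ℕ → Finset ℕ → X → ℝ, (∀ k, Codes pr T U n (Φ k)) ∧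
      ∀ (ν : Measure X) [IsProbabilityMeasure ν], ∀ ε > 0,
        ∃ k, val n (Φ k) ν ≤ aa pr T U ν n + ε := by
  choose Φ hΦ hΦ' using fun S => dense_codes (X := X) (Y := Y) (pr := pr) (W := coverIt T U S) hpr
    (coverIt_meas hT hUm S) (coverIt_cover hUc S)
  let I := (S : (Finset.range n).powerset) → (coverIt T U S.1 → ℕ)
  haveI : Nonempty I := ⟨fun _ _ => 0⟩
  obtain ⟨e, he⟩ := exists_surjective_nat I
  refine ⟨fun k S => if h : S ∈ (Finset.range n).powerset then Φ S (e k ⟨S, h⟩) else 0,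
    fun k S hS => ?_, fun ν _ ε hε => ?_⟩
  · simp only [hS, dif_pos]
    exact hΦ _ _
  · choose i hi using fun S => hΦ' S ν ε hε
    obtain ⟨k, hk⟩ := he fun S => i S.1
    refine ⟨k, ?_⟩
    conv_rhs => rw [← sum_pow n ε, aa, ← Finset.sum_add_distrib]
    rw [val]
    refine Finset.sum_le_sum fun S hS => ?_
    rw [← mul_add]
    refine mul_le_mul_of_nonneg_left ?_ (by positivity)
    simp only [hS, dif_pos, hk]
    exact hi S

lemma aa_subadd (hpr : Measurable pr) (hT : Measurable T) (hR : Measurable R)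
    (hfac : ∀ x, pr (T x) = R (pr x)) (hUc : IsCover U) (hUm : ∀ A ∈ U, MeasurableSet A)
    (ν : Measure X) [IsProbabilityMeasure ν] (hν : Measure.map T ν = ν) :
    Subadditive (aa pr T U ν) := by
  intro n m
  refine le_of_forall_pos_le_add fun ε hε => ?_
  obtain ⟨Φ, h1, h2⟩ := codes_dense (pr := pr) hpr hT hUc hUm n
  obtain ⟨Ψ, h3, h4⟩ := codes_dense (pr := pr) hpr hT hUc hUm m
  obtain ⟨k, hk⟩ := h2 ν (ε / 2) (by positivity)
  obtain ⟨l, hl⟩ := h4 ν (ε / 2) (by positivity)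
  obtain ⟨Θ, h5, h6⟩ := codes_add hpr hT hR hfac (h1 k) (h3 l)
  have := h6 ν hν
  have := aa_le hpr h5 ν
  linarith

lemma aa_tendsto (hpr : Measurable pr) (hT : Measurable T) (hR : Measurable R)
    (hfac : ∀ x, pr (T x) = R (pr x)) (hUc : IsCover U) (hUm : ∀ A ∈ U, MeasurableSet A)
    (ν : Measure X) [IsProbabilityMeasure ν] (hν : Measure.map T ν = ν) :
    Tendsto (fun n : ℕ => aa pr T U ν n / n) atTop (nhds (zAscCondMinus ν pr T U)) ∧
    ∀ n : ℕ, n ≠ 0 → zAscCondMinus ν pr T U ≤ aa pr T U ν n / n := by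
  have hs := aa_subadd hpr hT hR hfac hUc hUm ν hν
  have hb : BddBelow (range fun n : ℕ => aa pr T U ν n / n) := by
    refine ⟨0, ?_⟩
    rintro _ ⟨n, rfl⟩
    exact div_nonneg (aa_nonneg hpr ν n) n.cast_nonneg
  have ht := hs.tendsto_lim hb
  have e : zAscCondMinus ν pr T U = hs.lim := by
    unfold zAscCondMinus limSeq
    refine Tendsto.limUnder_eq (ht.congr fun n => ?_)
    simp only [aa]
    ring
  rw [e]
  exact ⟨ht, fun n hn => hs.lim_le_div hb hn⟩

end three

section four

open ProbabilityTheory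

lemma disint {X : Type*} [MeasurableSpace X] (μ : Measure X) [IsProbabilityMeasure μ]
    {Ω : Type*} [MeasurableSpace Ω] (m : Measure Ω) [IsProbabilityMeasure m]
    (μω : Ω → Measure X) (hprob : ∀ ω, IsProbabilityMeasure (μω ω))
    (hmeas : ∀ B : Set X, MeasurableSet B → Measurable fun ω => μω ω B)
    (hdis : ∀ B : Set X, MeasurableSet B → μ B = ∫⁻ ω, μω ω B ∂m)
    {φ : X → ℝ} (hφ : Measurable φ) (hb : ∃ C, ∀ x, |φ x| ≤ C) :
    Measurable (fun ω => ∫ x, φ x ∂(μω ω)) ∧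
      Integrable (fun ω => ∫ x, φ x ∂(μω ω)) m ∧
      ∫ x, φ x ∂μ = ∫ ω, ∫ x, φ x ∂(μω ω) ∂m := by
  obtain ⟨C, hC⟩ := hb
  let η : Kernel Ω X := ⟨μω, Measure.measurable_of_measurable_coe _ hmeas⟩
  haveI : IsMarkovKernel η := ⟨hprob⟩
  have hsm : Measurable (fun ω => ∫ x, φ x ∂(η ω)) := by
    have := hφ.stronglyMeasurable.integral_kernel (κ := η)
    exact this.measurable
  have he : μ = (η ∘ₖ Kernel.const Unit m) () := by
    ext B hB
    rw [Kernel.comp_apply' _ _ _ hB, hdis B hB]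
    rfl
  have hi : Integrable φ ((η ∘ₖ Kernel.const Unit m) ()) := by
    rw [← he]
    exact Integrable.of_bound hφ.aestronglyMeasurable C (Eventually.of_forall hC)
  refine ⟨hsm, hi.integral_comp, ?_⟩
  conv_lhs => rw [he]
  exact Kernel.integral_comp hi

variable {X : Type u} {Y : Type v} [MeasurableSpace X]
variable [MetricSpace Y] [CompactSpace Y] [MeasurableSpace Y] [BorelSpace Y]
variable {pr : X → Y} {T : X → X} {R : Y → Y} {U : Finset (Set X)}

lemma val_disint (μ : Measure X) [IsProbabilityMeasure μ]
    {Ω : Type*} [MeasurableSpace Ω] (m : Measure Ω) [IsProbabilityMeasure m]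
    (μω : Ω → Measure X) (hprob : ∀ ω, IsProbabilityMeasure (μω ω))
    (hmeas : ∀ B : Set X, MeasurableSet B → Measurable fun ω => μω ω B)
    (hdis : ∀ B : Set X, MeasurableSet B → μ B = ∫⁻ ω, μω ω B ∂m)
    (hpr : Measurable pr) {n : ℕ} {Φ : Finset ℕ → X → ℝ} (h : Codes pr T U n Φ) :
    Measurable (fun ω => val n Φ (μω ω)) ∧ Integrable (fun ω => val n Φ (μω ω)) m ∧
      val n Φ μ = ∫ ω, val n Φ (μω ω) ∂m := by
  have H := fun S hS => disint μ m μω hprob hmeas hdis ((h S hS).meas hpr) (h S hS).bdd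
  refine ⟨?_, ?_, ?_⟩
  · exact Finset.measurable_fun_sum _ fun S hS => (H S hS).1.const_mul _
  · exact integrable_finsetSum _ fun S hS => (H S hS).2.1.const_mul _
  · simp only [val]
    rw [integral_finsetSum _ fun S hS => (H S hS).2.1.const_mul _]
    refine Finset.sum_congr rfl fun S hS => ?_
    rw [integral_const_mul, (H S hS).2.2]

lemma main (hpr : Measurable pr) (hT : Measurable T) (hR : Measurable R)
    (hfac : ∀ x, pr (T x) = R (pr x)) (hUc : IsCover U) (hUm : ∀ A ∈ U, MeasurableSet A)
    (μ : Measure X) [IsProbabilityMeasure μ] (hinv : Measure.map T μ = μ)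
    {Ω : Type*} [MeasurableSpace Ω] (m : Measure Ω) [IsProbabilityMeasure m]
    (μω : Ω → Measure X) (hprob : ∀ ω, IsProbabilityMeasure (μω ω))
    (hinv' : ∀ ω, Measure.map T (μω ω) = μω ω)
    (hmeas : ∀ B : Set X, MeasurableSet B → Measurable fun ω => μω ω B)
    (hdis : ∀ B : Set X, MeasurableSet B → μ B = ∫⁻ ω, μω ω B ∂m) :
    zAscCondMinus μ pr T U = ∫ ω, zAscCondMinus (μω ω) pr T U ∂m := by
  have VD := fun {n : ℕ} {Φ : Finset ℕ → X → ℝ} (h : Codes pr T U n Φ) =>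
    val_disint μ m μω hprob hmeas hdis hpr h
  -- facts at level N
  have LV : ∀ N : ℕ, Measurable (fun ω => aa pr T U (μω ω) N) ∧
      Integrable (fun ω => aa pr T U (μω ω) N) m ∧
      ∫ ω, aa pr T U (μω ω) N ∂m ≤ aa pr T U μ N ∧
      (N ≠ 0 → zAscCondMinus μ pr T U ≤ (∫ ω, aa pr T U (μω ω) N ∂m) / N) := by
    intro N
    obtain ⟨Φ, hΦ, hd⟩ := codes_dense (pr := pr) hpr hT hUc hUm N
    let B : ℕ → Ω → ℝ := fun K ω => bmin (fun k => val N (Φ k) (μω ω)) K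
    have hB : ∀ K, Measurable (B K) := by
      intro K
      induction K with
      | zero => exact (VD (hΦ 0)).1
      | succ K ih => exact ih.min (VD (hΦ (K + 1))).1
    have hle : ∀ ω k, aa pr T U (μω ω) N ≤ val N (Φ k) (μω ω) := fun ω k =>
      haveI := hprob ω
      aa_le hpr (hΦ k) (μω ω)
    have h0 : ∀ ω, 0 ≤ aa pr T U (μω ω) N := fun ω =>
      haveI := hprob ω
      aa_nonneg hpr (μω ω) N
    have hBt : ∀ ω, Tendsto (fun K => B K ω) atTop (nhds (aa pr T U (μω ω) N)) := fun ω =>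
      haveI := hprob ω
      bmin_tendsto (hle ω) (hd (μω ω))
    have hm1 : Measurable (fun ω => aa pr T U (μω ω) N) :=
      measurable_of_tendsto_metrizable hB (tendsto_pi_nhds.2 hBt)
    obtain ⟨C, hC⟩ := val_bdd (hΦ 0)
    have hbd : ∀ K ω, ‖B K ω‖ ≤ C := fun K ω => by
      haveI := hprob ω
      have h1 : 0 ≤ B K ω := (h0 ω).trans (le_bmin _ (hle ω) K)
      have h2 : B K ω ≤ val N (Φ 0) (μω ω) := bmin_le _ (Nat.zero_le K)
      rw [Real.norm_eq_abs, abs_of_nonneg h1]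
      exact h2.trans ((le_abs_self _).trans (hC (μω ω)))
    have hBi : ∀ K, Integrable (B K) m := fun K =>
      Integrable.of_bound (hB K).aestronglyMeasurable C (Eventually.of_forall (hbd K))
    have hi1 : Integrable (fun ω => aa pr T U (μω ω) N) m := by
      refine Integrable.of_bound hm1.aestronglyMeasurable C (Eventually.of_forall fun ω => ?_)
      haveI := hprob ω
      rw [Real.norm_eq_abs, abs_of_nonneg (h0 ω)]
      exact (hle ω 0).trans ((le_abs_self _).trans (hC (μω ω)))
    have hDC : Tendsto (fun K => ∫ ω, B K ω ∂m) atTop (nhds (∫ ω, aa pr T U (μω ω) N ∂m)) :=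
      tendsto_integral_of_dominated_convergence (fun _ => C)
        (fun K => (hB K).aestronglyMeasurable) (integrable_const C)
        (fun K => Eventually.of_forall (hbd K)) (Eventually.of_forall hBt)
    refine ⟨hm1, hi1, ?_, fun hN => ?_⟩
    · refine le_of_forall_pos_le_add fun ε hε => ?_
      obtain ⟨k, hk⟩ := hd μ ε hε
      refine le_trans ?_ hk
      rw [(VD (hΦ k)).2.2]
      exact integral_mono hi1 (VD (hΦ k)).2.1 fun ω => hle ω k
    · have hNp : (0:ℝ) < N := by positivity
      refine ge_of_tendsto' (hDC.div_const (N : ℝ)) fun K => ?_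
      -- fixed K, every j
      have hj : ∀ j : ℕ, zAscCondMinus μ pr T U ≤
          (∫ ω, B K ω ∂m) / N + (K * Real.log 2 / N) * (1 / ((j : ℝ) + 1)) := by
        intro j
        choose Θ h1 h2 using fun k => codes_mul hpr hT hR hfac (hΦ k) j
        obtain ⟨Ξ, h3, h4⟩ := codes_mix hpr h1 K
        have hjp : (0:ℝ) < (j:ℝ) + 1 := by positivity
        have h5 := (aa_tendsto hpr hT hR hfac hUc hUm μ hinv).2 ((j + 1) * N)
          (Nat.mul_ne_zero (Nat.succ_ne_zero j) hN)
        have h6 := aa_le hpr h3 μ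
        rw [(VD h3).2.2] at h6
        have h7 : ∫ ω, val ((j + 1) * N) Ξ (μω ω) ∂m ≤
            ∫ ω, (((j:ℝ) + 1) * B K ω + K * Real.log 2) ∂m := by
          refine integral_mono (VD h3).2.1 (((hBi K).const_mul _).add (integrable_const _))
            fun ω => ?_
          haveI := hprob ω
          refine (h4 (μω ω)).trans ?_
          have := bmin_mono (fun k => h2 k (μω ω) (hinv' ω)) K
          rw [bmin_mul hjp.le] at this
          exact add_le_add_left this _
        rw [integral_add ((hBi K).const_mul _) (integrable_const _), integral_const_mul] at h7
        simp only [integral_const, probReal_univ, one_smul] at h7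
        refine h5.trans ?_
        have h8 := h6.trans h7
        push_cast
        rw [div_le_iff₀ (by positivity)]
        refine h8.trans (le_of_eq ?_)
        field_simp
      have ht : Tendsto (fun j : ℕ => (∫ ω, B K ω ∂m) / N +
          (K * Real.log 2 / N) * (1 / ((j : ℝ) + 1))) atTop (nhds ((∫ ω, B K ω ∂m) / N)) := by
        have := (tendsto_one_div_add_atTop_nhds_zero_nat (𝕜 := ℝ)).const_mul
          (K * Real.log 2 / N)
        simpa using this.const_add ((∫ ω, B K ω ∂m) / N)
      exact ge_of_tendsto' ht hj
  -- uniform bound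
  obtain ⟨Φ, hΦ, -⟩ := codes_dense (pr := pr) hpr hT hUc hUm 1
  obtain ⟨C, hC⟩ := val_bdd (hΦ 0)
  have hub : ∀ (N : ℕ) ω, ‖aa pr T U (μω ω) (N + 1) / ((N + 1 : ℕ) : ℝ)‖ ≤ C := by
    intro N ω
    haveI := hprob ω
    obtain ⟨Θ, h1, h2⟩ := codes_mul hpr hT hR hfac (hΦ 0) N
    have h3 := (aa_le hpr h1 (μω ω)).trans (h2 (μω ω) (hinv' ω))
    rw [mul_one] at h3
    rw [Real.norm_eq_abs, abs_of_nonneg (div_nonneg (aa_nonneg hpr _ _) (Nat.cast_nonneg _)),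
      div_le_iff₀ (by positivity)]
    have h4 := (le_abs_self _).trans (hC (μω ω))
    have : (0:ℝ) ≤ N + 1 := by positivity
    push_cast
    nlinarith
  have hfin : Tendsto (fun N : ℕ => ∫ ω, aa pr T U (μω ω) (N + 1) / ((N + 1 : ℕ) : ℝ) ∂m) atTop
      (nhds (∫ ω, zAscCondMinus (μω ω) pr T U ∂m)) := by
    refine tendsto_integral_of_dominated_convergence (fun _ => C)
      (fun N => ((LV (N + 1)).1.div_const _).aestronglyMeasurable) (integrable_const C)
      (fun N => Eventually.of_forall (hub N)) (Eventually.of_forall fun ω => ?_)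
    haveI := hprob ω
    exact (tendsto_add_atTop_iff_nat (f := fun n : ℕ => aa pr T U (μω ω) n / n) 1).2
      (aa_tendsto hpr hT hR hfac hUc hUm (μω ω) (hinv' ω)).1
  have hμt := (tendsto_add_atTop_iff_nat (f := fun n : ℕ => aa pr T U μ n / n) 1).2
      (aa_tendsto hpr hT hR hfac hUc hUm μ hinv).1
  refine le_antisymm ?_ ?_
  · refine ge_of_tendsto' hfin fun N => ?_
    rw [integral_div]
    exact (LV (N + 1)).2.2.2 (Nat.succ_ne_zero N)
  · refine le_of_tendsto_of_tendsto' hfin hμt fun N => ?_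
    rw [integral_div]
    exact div_le_div_of_nonneg_right (LV (N + 1)).2.2.1 (Nat.cast_nonneg _)

end four

end Sub13

theorem statement13 {X Y : Type*}
    [MetricSpace X] [CompactSpace X] [MeasurableSpace X] [BorelSpace X]
    [MetricSpace Y] [CompactSpace Y] [MeasurableSpace Y] [BorelSpace Y]
    (T : X ≃ₜ X) (R : Y ≃ₜ Y)
    (π : X → Y) (hπc : Continuous π) (hπs : Function.Surjective π)
    (hfac : ∀ x : X, π (T x) = R (π x))
    (μ : Measure X) (hμ : IsProbabilityMeasure μ) (hinv : Measure.map (⇑T) μ = μ)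
    (U : Finset (Set X)) (hUc : IsCover U) (hUm : ∀ A ∈ U, MeasurableSet A)
    (Ω : Type*) [MeasurableSpace Ω] (m : Measure Ω) (hm : IsProbabilityMeasure m)
    (μω : Ω → Measure X) (hprob : ∀ ω, IsProbabilityMeasure (μω ω))
    (hergInv : ∀ ω, Measure.map (⇑T) (μω ω) = μω ω)
    (herg : ∀ ω, ∀ A : Set X, MeasurableSet A → (⇑T) ⁻¹' A = A →
      μω ω A = 0 ∨ μω ω A = 1)
    (hmeas : ∀ B : Set X, MeasurableSet B → Measurable fun ω => μω ω B)
    (hdis : ∀ B : Set X, MeasurableSet B → μ B = ∫⁻ ω, μω ω B ∂m) :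
    zAscCondMinus μ π (⇑T) U = ∫ ω, zAscCondMinus (μω ω) π (⇑T) U ∂m := by
  exact Sub13.main hπc.measurable T.continuous.measurable R.continuous.measurable hfac hUc hUm μ hinv m μω
    hprob hergInv hmeas hdis
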